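/- Let G be a generator and K a specification with cl(K) ∩ Lm(G) ⊆ K, and let K↑ = supC(K ∩ Lm(G)). If K↑ ≠ ∅, then there exists a nonblocking supervisor V for G such that Lm(V/G) = K↑. -/

import Mathlib

open Classical

/-! ### Behaviors, systems, histories, traces (AI behavior composition) -/

/-- A behavior: a transition system with an initial state over actions `Act`. -/
structure Behavior (State : Type) (Act : Type) where
  init : State
  trans : State → Act → State → Prop

/-- A behavior is deterministic if successors are unique. -/
def Behavior.Deterministic {State Act : Type} (B : Behavior State Act) : Prop :=
  ∀ s a s' s'', B.trans s a s' → B.trans s a s'' → s' = s''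

/-- The initial state of the enacted system of `S = (B_1, ..., B_n)`. -/
def sysInit {n : ℕ} {SB Act : Type} (S : Fin n → Behavior SB Act) : Fin n → SB :=
  fun i => (S i).init

/-- Enacted-system transition `b −a,j→ b'`. -/
def sysTrans {n : ℕ} {SB Act : Type} (S : Fin n → Behavior SB Act)
    (b : Fin n → SB) (a : Act) (j : Fin n) (b' : Fin n → SB) : Prop :=
  (S j).trans (b j) a (b' j) ∧ ∀ i, i ≠ j → b i = b' i

/-- One step of a system history: action, delegated index, and resulting system state. -/
abbrev Step (SB Act : Type) (n : ℕ) := Act × Fin n × (Fin n → SB)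

/-- Last system state of a history (initial state for the empty history). -/
def lastState {n : ℕ} {SB Act : Type} (S : Fin n → Behavior SB Act)
    (h : List (Step SB Act n)) : Fin n → SB :=
  match h.getLast? with
  | none => sysInit S
  | some s => s.2.2

/-- `h` is a system history: a finite sequence of consecutive enacted-system
transitions starting from the initial system state. -/
inductive ValidHist {n : ℕ} {SB Act : Type} (S : Fin n → Behavior SB Act) :
    List (Step SB Act n) → Prop
  | nil : ValidHist S []
  | snoc {h : List (Step SB Act n)} {a : Act} {j : Fin n} {b : Fin n → SB} :
      ValidHist S h → sysTrans S (lastState S h) a j b → ValidHist S (h ++ [(a, j, b)])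

/-- A (finite or infinite) trace of a behavior `B`, starting at the initial state:
`acts i` is the (i+1)-st action, leading from `states i` to `states (i+1)`,
for all `i <` the length `len : ℕ∞`. -/
structure Trace {State Act : Type} (B : Behavior State Act) where
  len : ℕ∞
  states : ℕ → State
  acts : ℕ → Act
  init_eq : states 0 = B.init
  step : ∀ i : ℕ, (i : ℕ∞) < len → B.trans (states i) (acts i) (states (i + 1))

/-- The set `H_{P,τ}` of `(P,τ)`-induced system histories, for an
action-request controller `P`. -/
inductive Induced {n : ℕ} {SB ST Act : Type} (S : Fin n → Behavior SB Act)
    {T : Behavior ST Act} (P : List (Step SB Act n) → Act → Fin n) (τ : Trace T) :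
    List (Step SB Act n) → Prop
  | nil : Induced S P τ []
  | snoc {h : List (Step SB Act n)} {j : Fin n} {b : Fin n → SB} :
      Induced S P τ h → (h.length : ℕ∞) < τ.len →
      j = P h (τ.acts h.length) →
      sysTrans S (lastState S h) (τ.acts h.length) j b →
      Induced S P τ (h ++ [(τ.acts h.length, j, b)])

/-- `P` realizes the target trace `τ` in system `S`. -/
def Realizes {n : ℕ} {SB ST Act : Type} (S : Fin n → Behavior SB Act)
    {T : Behavior ST Act} (P : List (Step SB Act n) → Act → Fin n) (τ : Trace T) : Prop :=
  ∀ h, Induced S P τ h → (h.length : ℕ∞) < τ.len →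
    ∃ b', sysTrans S (lastState S h) (τ.acts h.length) (P h (τ.acts h.length)) b'

/-- `P` is an exact composition of the target `T` in system `S`. -/
def ExactComposition {n : ℕ} {SB ST Act : Type} (S : Fin n → Behavior SB Act)
    (T : Behavior ST Act) (P : List (Step SB Act n) → Act → Fin n) : Prop :=
  ∀ τ : Trace T, Realizes S P τ

/-- `R` is an nd-simulation of the target `T` by the enacted system of `S`. -/
def IsNDSim {n : ℕ} {SB ST Act : Type} (T : Behavior ST Act)
    (S : Fin n → Behavior SB Act) (R : ST → (Fin n → SB) → Prop) : Prop :=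
  ∀ t b, R t b → ∀ a t', T.trans t a t' →
    ∃ j : Fin n, (∃ b', sysTrans S b a j b') ∧ ∀ b', sysTrans S b a j b' → R t' b'

/-- `t ≼_ND b` : `(t,b)` belongs to some nd-simulation. -/
def NDSimulated {n : ℕ} {SB ST Act : Type} (T : Behavior ST Act)
    (S : Fin n → Behavior SB Act) (t : ST) (b : Fin n → SB) : Prop :=
  ∃ R, IsNDSim T S R ∧ R t b

/-! ### Generators and supervisory control -/

/-- A generator (deterministic automaton with partial transition function,
marked states, and a distinguished set of controllable events; the
uncontrollable events are the complement). -/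
structure Generator (E : Type) (Q : Type) where
  controllable : Set E
  init : Q
  step : Q → E → Option Q
  marked : Set Q

/-- Run a generator from a state on a word. -/
def Generator.runFrom {E Q : Type} (G : Generator E Q) : Q → List E → Option Q
  | q, [] => some q
  | q, σ :: w =>
    match G.step q σ with
    | none => none
    | some q' => G.runFrom q' w

/-- Run a generator from its initial state. -/
def Generator.run {E Q : Type} (G : Generator E Q) (w : List E) : Option Q :=
  G.runFrom G.init w

/-- The generated language `L(G)`. -/
def Generator.Lang {E Q : Type} (G : Generator E Q) : Set (List E) :=
  { w | (G.run w).isSome }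

/-- The marked language `Lm(G)`. -/
def Generator.MLang {E Q : Type} (G : Generator E Q) : Set (List E) :=
  { w | ∃ q, G.run w = some q ∧ q ∈ G.marked }

/-- Prefix closure of a language. -/
def cl {E : Type} (K : Set (List E)) : Set (List E) := { w | ∃ v, w ++ v ∈ K }

/-- A language is closed if it equals its prefix closure. -/
def IsClosedLang {E : Type} (K : Set (List E)) : Prop := K = cl K

/-- `K` is controllable in `G`: `cl(K)·Σu ∩ L(G) ⊆ cl(K)`. -/
def ControllableIn {E Q : Type} (G : Generator E Q) (K : Set (List E)) : Prop :=
  ∀ w σ, w ∈ cl K → σ ∉ G.controllable → w ++ [σ] ∈ G.Lang → w ++ [σ] ∈ cl K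

/-- A supervisor for `G`: enables a set of events after each generated word,
always including all uncontrollable events. -/
def IsSupervisor {E Q : Type} (G : Generator E Q) (V : List E → Set E) : Prop :=
  ∀ w ∈ G.Lang, ∀ σ, σ ∉ G.controllable → σ ∈ V w

/-- The controlled language `L(V/G)` (as an inductive predicate: the smallest
language containing ε and closed under enabled extensions). -/
inductive CtrlLang {E Q : Type} (G : Generator E Q) (V : List E → Set E) : List E → Prop
  | nil : CtrlLang G V []
  | snoc {w : List E} {σ : E} :
      CtrlLang G V w → w ++ [σ] ∈ G.Lang → σ ∈ V w → CtrlLang G V (w ++ [σ])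

/-- `L(V/G)` as a set. -/
def ctrlLang {E Q : Type} (G : Generator E Q) (V : List E → Set E) : Set (List E) :=
  { w | CtrlLang G V w }

/-- `Lm(V/G) = L(V/G) ∩ Lm(G)`. -/
def mCtrlLang {E Q : Type} (G : Generator E Q) (V : List E → Set E) : Set (List E) :=
  ctrlLang G V ∩ G.MLang

/-- `V` is nonblocking in `G`. -/
def Nonblocking {E Q : Type} (G : Generator E Q) (V : List E → Set E) : Prop :=
  ctrlLang G V = cl (mCtrlLang G V)

/-- The supremal controllable sublanguage of `K` in `G`: the union of all
controllable sublanguages of `K`. -/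
def supC {E Q : Type} (G : Generator E Q) (K : Set (List E)) : Set (List E) :=
  ⋃₀ { K' | K' ⊆ K ∧ ControllableIn G K' }

/-! ### The composition plant -/

/-- Events of the composition plant: target actions, behavior indexes, behavior states. -/
abbrev PlantEvent (SB Act : Type) (n : ℕ) := Act ⊕ (Fin n ⊕ SB)

/-- States of the composition plant: target state, system state, pending request
(`none` = `e`), pending delegation (`none` = `0`). -/
abbrev PlantState (SB ST Act : Type) (n : ℕ) :=
  ST × (Fin n → SB) × Option Act × Option (Fin n)

/-- The composition plant `G_{S,T}`. -/
noncomputable def compPlant {n : ℕ} {SB ST Act : Type}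
    (S : Fin n → Behavior SB Act) (T : Behavior ST Act) :
    Generator (PlantEvent SB Act n) (PlantState SB ST Act n) where
  controllable := { σ | ∃ j : Fin n, σ = Sum.inr (Sum.inl j) }
  init := (T.init, sysInit S, none, none)
  step := fun q σ =>
    match q.2.2.1, q.2.2.2, σ with
    | none, none, Sum.inl a =>
        if h : ∃ t', T.trans q.1 a t' then some (h.choose, q.2.1, some a, none) else none
    | some a, none, Sum.inr (Sum.inl j) => some (q.1, q.2.1, some a, some j)
    | some a, some j, Sum.inr (Sum.inr s) =>
        if (S j).trans (q.2.1 j) a s then some (q.1, Function.update q.2.1 j s, none, none)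
        else none
    | _, _, _ => none
  marked := { q | q.2.2.1 = none ∧ q.2.2.2 = none }

/-- The word of a system history: each step `(a, j, b)` contributes
`a · j · st_j(b)`. -/
def histWord {n : ℕ} {SB Act : Type} (h : List (Step SB Act n)) :
    List (PlantEvent SB Act n) :=
  h.foldr
    (fun s acc =>
      Sum.inl s.1 :: Sum.inr (Sum.inl s.2.1) :: Sum.inr (Sum.inr (s.2.2 s.2.1)) :: acc) []

/-- A controller `P` is induced by a supervisor `V` for the composition plant:
`P(h,σ) ∈ V(word(h)·σ)` for every system history `h` and action `σ`. -/
def InducedBySupervisor {n : ℕ} {SB Act : Type} (S : Fin n → Behavior SB Act)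
    (V : List (PlantEvent SB Act n) → Set (PlantEvent SB Act n))
    (P : List (Step SB Act n) → Act → Fin n) : Prop :=
  ∀ h, ValidHist S h → ∀ a : Act,
    Sum.inr (Sum.inl (P h a)) ∈ V (histWord h ++ [Sum.inl a])

/-- Words of shape `(A_t · Indx · Succ)*`. -/
inductive TriWord {n : ℕ} {SB Act : Type} : List (PlantEvent SB Act n) → Prop
  | nil : TriWord []
  | cons {a : Act} {j : Fin n} {s : SB} {w : List (PlantEvent SB Act n)} :
      TriWord w → TriWord (Sum.inl a :: Sum.inr (Sum.inl j) :: Sum.inr (Sum.inr s) :: w)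

/-- The selection function `ω` of the DES controller generator extracted from the
generator `R` (with `dec` decoding composition states from `R`-states):
`ω(q, σ)` is the set of indexes `j` such that some reachable `R`-state decoding
to `q` has an outgoing `σ·j·b'` run. -/
def cgOmega {n : ℕ} {SB ST Act Y : Type} (R : Generator (PlantEvent SB Act n) Y)
    (dec : Y → ST × (Fin n → SB)) (q : ST × (Fin n → SB)) (σ : Act) : Set (Fin n) :=
  { j | ∃ y s, (∃ p, TriWord p ∧ R.run p = some y) ∧ dec y = q ∧
      (R.runFrom y [Sum.inl σ, Sum.inr (Sum.inl j), Sum.inr (Sum.inr s)]).isSome }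

/-- A controller `P` is generated by the DES controller generator extracted
from `R`: all its delegations are allowed by `ω` at the decoded composition
state reached by the word of the current history. -/
def GeneratedBy {n : ℕ} {SB ST Act Y : Type} (S : Fin n → Behavior SB Act)
    (R : Generator (PlantEvent SB Act n) Y) (dec : Y → ST × (Fin n → SB))
    (P : List (Step SB Act n) → Act → Fin n) : Prop :=
  ∀ h, ValidHist S h → ∀ σ : Act, ∀ y, R.run (histWord h) = some y →
    P h σ ∈ cgOmega R dec (dec y) σ

/-! ### Simulation, RTFs and the maximal composition plant -/

/-- `B2 ≼ B1` : a simulation of `B2` by `B1` relating their initial states. -/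
def Simulates {S2 S1 Act : Type} (B2 : Behavior S2 Act) (B1 : Behavior S1 Act) : Prop :=
  ∃ R : S2 → S1 → Prop,
    (∀ s2 s1, R s2 s1 → ∀ a s2', B2.trans s2 a s2' → ∃ s1', B1.trans s1 a s1' ∧ R s2' s1') ∧
    R B2.init B1.init

/-- The induced histories `H_{P,τ}` for a transition-request controller `P`. -/
inductive TInduced {n : ℕ} {SB ST' Act : Type} (S : Fin n → Behavior SB Act)
    {T' : Behavior ST' Act} (P : List (Step SB Act n) → ST' × Act × ST' → Fin n)
    (τ : Trace T') : List (Step SB Act n) → Prop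
  | nil : TInduced S P τ []
  | snoc {h : List (Step SB Act n)} {j : Fin n} {b : Fin n → SB} :
      TInduced S P τ h → (h.length : ℕ∞) < τ.len →
      j = P h (τ.states h.length, τ.acts h.length, τ.states (h.length + 1)) →
      sysTrans S (lastState S h) (τ.acts h.length) j b →
      TInduced S P τ (h ++ [(τ.acts h.length, j, b)])

/-- A transition-request controller `P` realizes the trace `τ`. -/
def TRealizes {n : ℕ} {SB ST' Act : Type} (S : Fin n → Behavior SB Act)
    {T' : Behavior ST' Act} (P : List (Step SB Act n) → ST' × Act × ST' → Fin n)
    (τ : Trace T') : Prop :=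
  ∀ h, TInduced S P τ h → (h.length : ℕ∞) < τ.len →
    ∃ b', sysTrans S (lastState S h) (τ.acts h.length)
      (P h (τ.states h.length, τ.acts h.length, τ.states (h.length + 1))) b'

/-- `P` is an exact composition of the (possibly nondeterministic) target `T'`
in `S`, with transition requests. -/
def TExactComposition {n : ℕ} {SB ST' Act : Type} (S : Fin n → Behavior SB Act)
    (T' : Behavior ST' Act) (P : List (Step SB Act n) → ST' × Act × ST' → Fin n) : Prop :=
  ∀ τ : Trace T', TRealizes S P τ

/-- `T'` is a realizable target fragment (RTF) of `T` in `S`. -/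
def IsRTF {n : ℕ} {SB ST ST' Act : Type} (S : Fin n → Behavior SB Act)
    (T : Behavior ST Act) (T' : Behavior ST' Act) : Prop :=
  Simulates T' T ∧ ∃ P, TExactComposition S T' P

/-- `T'` is a supremal realizable target fragment (SRTF) of `T` in `S`. -/
def IsSRTF {n : ℕ} {SB ST ST' Act : Type} (S : Fin n → Behavior SB Act)
    (T : Behavior ST Act) (T' : Behavior ST' Act) : Prop :=
  IsRTF S T T' ∧ ∀ (ST'' : Type) (T'' : Behavior ST'' Act), IsRTF S T T'' →
    Simulates T' T'' → Simulates T'' T'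

/-- Events of the maximal composition plant: target transitions and behavior indexes. -/
abbrev MaxEvent (ST Act : Type) (n : ℕ) := (ST × Act × ST) ⊕ Fin n

/-- States of the maximal composition plant. -/
abbrev MaxState (SB ST Act : Type) (n : ℕ) := ST × (Fin n → SB) × Option (ST × Act × ST)

/-- The maximal composition plant `Ĝ_{S,T}` (for a deterministic system `S`);
all events are controllable. -/
noncomputable def maxPlant {n : ℕ} {SB ST Act : Type}
    (S : Fin n → Behavior SB Act) (T : Behavior ST Act) :
    Generator (MaxEvent ST Act n) (MaxState SB ST Act n) where
  controllable := Set.univ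
  init := (T.init, sysInit S, none)
  step := fun q σ =>
    match q.2.2, σ with
    | none, Sum.inl θ =>
        if T.trans θ.1 θ.2.1 θ.2.2 then some (q.1, q.2.1, some θ) else none
    | some θ, Sum.inr j =>
        if h : θ.1 = q.1 ∧ ∃ s', (S j).trans (q.2.1 j) θ.2.1 s' then
          some (θ.2.2, Function.update q.2.1 j h.2.choose, none)
        else none
    | _, _ => none
  marked := { q | q.2.2 = none }

/-- `MaxWordH T t h w tf` : `w` is the word `(θ1·j1)⋯(θℓ·jℓ)` of history `h`,
where `θi` is the transition of `T` on the i-th action of `h` from the `T`-state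
reached so far (starting at `t`), and `tf` is the final `T`-state reached. -/
inductive MaxWordH {n : ℕ} {SB ST Act : Type} (T : Behavior ST Act) :
    ST → List (Step SB Act n) → List (MaxEvent ST Act n) → ST → Prop
  | nil {t : ST} : MaxWordH T t [] [] t
  | cons {t t' tf : ST} {a : Act} {j : Fin n} {b : Fin n → SB}
      {rest : List (Step SB Act n)} {w : List (MaxEvent ST Act n)} :
      T.trans t a t' → MaxWordH T t' rest w tf →
      MaxWordH T t ((a, j, b) :: rest) (Sum.inl (t, a, t') :: Sum.inr j :: w) tf

/-- The extracted target `T*_{S,T}` from a generator `R` for `K̂↑`: states are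
`R`-states, with a transition on action `a` whenever `R` can run a request
`θ = (t,a,t') ∈ δ_t` followed by a delegation `j`. -/
def extractedTarget {n : ℕ} {ST Act Y : Type} (T : Behavior ST Act)
    (R : Generator (MaxEvent ST Act n) Y) : Behavior Y Act where
  init := R.init
  trans := fun y a y' => ∃ (t t' : ST) (j : Fin n),
    T.trans t a t' ∧ R.runFrom y [Sum.inl (t, a, t'), Sum.inr j] = some y'

/-- The generated language is prefix-closed. -/
theorem Generator.cl_lang_subset {E Q : Type} (G : Generator E Q) : cl G.Lang ⊆ G.Lang := by
  suffices h : ∀ (w v : List E) (q : Q),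
      (G.runFrom q (w ++ v)).isSome → (G.runFrom q w).isSome by
    rintro w ⟨v, hv⟩
    exact h w v G.init hv
  intro w
  induction w with
  | nil => intro v q _; rfl
  | cons σ w ih =>
    intro v q h
    simp only [List.cons_append, Generator.runFrom] at h ⊢
    cases hq : G.step q σ with
    | none => simp [hq] at h
    | some q' =>
      rw [hq] at h
      exact ih v q' h

/-- Every marked word is generated. -/
theorem Generator.mLang_subset_lang {E Q : Type} (G : Generator E Q) : G.MLang ⊆ G.Lang := by
  rintro w ⟨q, hq, _⟩
  simp [Generator.Lang, hq]

/-- Every language is contained in its prefix closure. -/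
theorem subset_cl {E : Type} (K : Set (List E)) : K ⊆ cl K :=
  fun w hw => ⟨[], by simpa using hw⟩

/-- Prefix closure is monotone. -/
theorem cl_mono {E : Type} {K K' : Set (List E)} (h : K ⊆ K') : cl K ⊆ cl K' :=
  fun _ ⟨v, hv⟩ => ⟨v, h hv⟩

/-- The prefix closure of a language is prefix-closed. -/
theorem mem_cl_of_append_mem_cl {E : Type} {K : Set (List E)} {w v : List E}
    (h : w ++ v ∈ cl K) : w ∈ cl K := by
  obtain ⟨u, hu⟩ := h
  exact ⟨v ++ u, by simpa using hu⟩

/-- The supremal controllable sublanguage of `K` is contained in `K`. -/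
theorem supC_subset {E Q : Type} (G : Generator E Q) (K : Set (List E)) : supC G K ⊆ K :=
  Set.sUnion_subset fun _ h => h.1

/-- The supremal controllable sublanguage is controllable. -/
theorem controllableIn_supC {E Q : Type} (G : Generator E Q) (K : Set (List E)) :
    ControllableIn G (supC G K) := by
  rintro w σ ⟨v, K', hK', hv⟩ hσ hw
  exact cl_mono (Set.subset_sUnion_of_mem hK') (hK'.2 w σ ⟨v, hv⟩ hσ hw)

/-- If `K` contains the marked words of its closure, then so does `supC G (K ∩ G.MLang)`. -/
theorem cl_supC_inter_mLang {E Q : Type} (G : Generator E Q) (K : Set (List E))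
    (hmp : cl K ∩ G.MLang ⊆ K) :
    cl (supC G (K ∩ G.MLang)) ∩ G.MLang = supC G (K ∩ G.MLang) := by
  have hsup := supC_subset G (K ∩ G.MLang)
  have hle : supC G (K ∩ G.MLang) ⊆ cl (supC G (K ∩ G.MLang)) ∩ G.MLang :=
    fun w hw => ⟨subset_cl _ hw, (hsup hw).2⟩
  refine Set.Subset.antisymm (Set.subset_sUnion_of_mem ⟨fun w hw => ⟨hmp ⟨?_, hw.2⟩, hw.2⟩, ?_⟩) hle
  · exact cl_mono (hsup.trans Set.inter_subset_left) hw.1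
  · rintro w σ ⟨v, hv⟩ hσ hw
    exact cl_mono hle
      (controllableIn_supC G _ w σ (mem_cl_of_append_mem_cl hv.1) hσ hw)

/-- Enabling the uncontrollable events and those that stay in `cl K` yields exactly `cl K` as
controlled language, for `K` nonempty, controllable and contained in the generated language. -/
theorem ctrlLang_eq_cl {E Q : Type} (G : Generator E Q) {K : Set (List E)} (hne : K.Nonempty)
    (hsub : K ⊆ G.Lang) (hK : ControllableIn G K) :
    ctrlLang G (fun w => {σ | σ ∉ G.controllable ∨ w ++ [σ] ∈ cl K}) = cl K := by
  apply Set.Subset.antisymm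
  · intro w hw
    induction hw with
    | nil => exact hne
    | snoc _ hL hV ih => exact hV.elim (fun hσ => hK _ _ ih hσ hL) id
  · intro w
    induction w using List.reverseRecOn with
    | nil => exact fun _ => CtrlLang.nil
    | append_singleton w σ ih =>
      intro hw
      exact CtrlLang.snoc (ih (mem_cl_of_append_mem_cl hw))
        (G.cl_lang_subset (cl_mono hsub hw)) (Or.inr hw)

/-- nonblocking supervisor for the supremal marked
specification: if `cl(K) ∩ Lm(G) ⊆ K` and `K↑ = supC(K ∩ Lm(G)) ≠ ∅`, then
there is a nonblocking supervisor `V` with `Lm(V/G) = K↑`. -/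
theorem nonblocking_supervisor_exists {E Q : Type} [Fintype E] [Fintype Q]
    (G : Generator E Q) (K : Set (List E)) (hsub : K ⊆ G.Lang)
    (hmp : cl K ∩ G.MLang ⊆ K)
    (hne : supC G (K ∩ G.MLang) ≠ ∅) :
    ∃ V : List E → Set E, IsSupervisor G V ∧ Nonblocking G V ∧
      mCtrlLang G V = supC G (K ∩ G.MLang) := by
  have hctrl := ctrlLang_eq_cl G (Set.nonempty_iff_ne_empty.mpr hne)
    (((supC_subset G _).trans Set.inter_subset_right).trans G.mLang_subset_lang)
    (controllableIn_supC G (K ∩ G.MLang))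
  have hmarked := cl_supC_inter_mLang G K hmp
  rw [← hctrl] at hmarked
  refine ⟨_, fun w _ σ hσ => Or.inl hσ, ?_, hmarked⟩
  exact hctrl.trans (congrArg cl hmarked.symm)
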